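/- arXiv:2205.02477 — 3 statements merged into one kernel-verified Lean document; each statement's English description precedes it below -/
import Mathlib

section
/- Let f be a set-ordered odd-graceful total labeling of a connected bipartite graph G with bipartition (X,Y) and q edges. Define a total labeling f* by f*(w) = (2q − 1) − f(w) for each vertex w and f*(xy) = 2q − f(xy) for each edge xy, where f(xy) = |f(x) − f(y)|. Then f* is injective on vertices with max f*(Y) < min f*(X), its edge colors form exactly the odd set {1,3,…,2q−1}, and for every edge xy one has f*(xy) + |f*(x) − f*(y)| = 2q; that is, G admits a set-ordered odd-edge edge-difference total labeling with magic constant 2q. -/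
/-- From a set-ordered odd-graceful total labeling `f` of a connected
bipartite graph `G` with `q` edges, the total labeling `f*` given by
`f*(w) = (2q - 1) - f(w)` on vertices and `f*(xy) = 2q - f(xy)` on edges is a set-ordered
odd-edge edge-difference total labeling with magic constant `2q`: `f*` is injective on
vertices with `max f*(Y) < min f*(X)`, its edge colors form exactly `{1, 3, …, 2q - 1}`,
and `f*(xy) + |f*(x) - f*(y)| = 2q` for every edge `xy`. -/
theorem odd_graceful_gives_odd_edge_edge_difference
    {V : Type*} [Fintype V] [DecidableEq V]
    (G : SimpleGraph V) [DecidableRel G.Adj]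
    (hconn : G.Connected)
    (X Y : Finset V) (hXne : X.Nonempty) (hYne : Y.Nonempty)
    (hdisj : Disjoint X Y) (hcover : X ∪ Y = Finset.univ)
    (hbip : ∀ u v, G.Adj u v → (u ∈ X ∧ v ∈ Y) ∨ (u ∈ Y ∧ v ∈ X))
    (q : ℕ) (hq : q = G.edgeFinset.card) (hq1 : 1 ≤ q)
    (f : V → ℕ) (hinj : Function.Injective f) (hbd : ∀ v, f v ≤ 2 * q - 1)
    (hedges : {n : ℕ | ∃ u v, G.Adj u v ∧ n = Nat.dist (f u) (f v)}
        = {n : ℕ | Odd n ∧ n < 2 * q})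
    (hso : ∀ x ∈ X, ∀ y ∈ Y, f x < f y) :
    Function.Injective (fun w => (2 * q - 1) - f w) ∧
    (∀ y ∈ Y, ∀ x ∈ X, (2 * q - 1) - f y < (2 * q - 1) - f x) ∧
    {n : ℕ | ∃ u v, G.Adj u v ∧ n = 2 * q - Nat.dist (f u) (f v)}
        = {n : ℕ | Odd n ∧ n < 2 * q} ∧
    (∀ u v, G.Adj u v →
      (2 * q - Nat.dist (f u) (f v))
        + Nat.dist ((2 * q - 1) - f u) ((2 * q - 1) - f v) = 2 * q) := by
  have hE : ∀ n : ℕ, (∃ u v, G.Adj u v ∧ n = Nat.dist (f u) (f v)) ↔ (Odd n ∧ n < 2 * q) :=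
    fun n => Set.ext_iff.mp hedges n
  refine ⟨?_, ?_, ?_, ?_⟩
  · intro a b hab
    have ha := hbd a
    have hb := hbd b
    simp only at hab
    exact hinj (by omega)
  · intro y hy x hx
    have h1 := hso x hx y hy
    have h2 := hbd y
    omega
  · ext n
    simp only [Set.mem_setOf_eq]
    constructor
    · rintro ⟨u, v, huv, hn⟩
      obtain ⟨⟨k, hk⟩, hlt⟩ := (hE _).mp ⟨u, v, huv, rfl⟩
      refine ⟨⟨q - k - 1, ?_⟩, ?_⟩ <;> omega
    · rintro ⟨⟨k, hk⟩, hlt⟩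
      obtain ⟨u, v, huv, hn⟩ := (hE (2 * q - n)).mpr ⟨⟨q - k - 1, by omega⟩, by omega⟩
      exact ⟨u, v, huv, by omega⟩
  · intro u v _
    have hu := hbd u
    have hv := hbd v
    unfold Nat.dist
    omega
end

section
/- Let f be a set-ordered odd-graceful total labeling of a connected bipartite graph G with bipartition (X,Y) and q edges. Define a total labeling g* by g*(x) = max f(X) − f(x) for x ∈ X, g*(y) = (2q − 1) + min f(Y) − f(y) for y ∈ Y, and g*(xy) = 2q − f(xy) for each edge xy, where f(xy) = |f(x) − f(y)|. Then g* is injective on vertices with max g*(X) < min g*(Y), its edge colors form exactly the odd set {1,3,…,2q−1}, and for every edge xy one has ||g*(x) − g*(y)| − g*(xy)| = min f(Y) − max f(X) − 1; that is, g* is a set-ordered odd-edge graceful-difference total labeling of G. -/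
/-- From a set-ordered odd-graceful total labeling `f` of a connected
bipartite graph `G` with `q` edges, the total labeling `g*` given by
`g*(x) = max f(X) - f(x)` on `X`, `g*(y) = (2q - 1) + min f(Y) - f(y)` on `Y` and
`g*(xy) = 2q - f(xy)` on edges is a set-ordered odd-edge graceful-difference total
labeling: `g*` is injective on vertices with `max g*(X) < min g*(Y)`, its edge colors
form exactly `{1, 3, …, 2q - 1}`, and
`||g*(x) - g*(y)| - g*(xy)| = min f(Y) - max f(X) - 1` for every edge `xy`. -/
theorem odd_graceful_gives_odd_edge_graceful_difference
    {V : Type*} [Fintype V] [DecidableEq V]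
    (G : SimpleGraph V) [DecidableRel G.Adj]
    (hconn : G.Connected)
    (X Y : Finset V) (hXne : X.Nonempty) (hYne : Y.Nonempty)
    (hdisj : Disjoint X Y) (hcover : X ∪ Y = Finset.univ)
    (hbip : ∀ u v, G.Adj u v → (u ∈ X ∧ v ∈ Y) ∨ (u ∈ Y ∧ v ∈ X))
    (q : ℕ) (hq : q = G.edgeFinset.card) (hq1 : 1 ≤ q)
    (f : V → ℕ) (hinj : Function.Injective f) (hbd : ∀ v, f v ≤ 2 * q - 1)
    (hedges : {n : ℕ | ∃ u v, G.Adj u v ∧ n = Nat.dist (f u) (f v)}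
        = {n : ℕ | Odd n ∧ n < 2 * q})
    (hso : ∀ x ∈ X, ∀ y ∈ Y, f x < f y) :
    let mX := X.sup' hXne f
    let nY := Y.inf' hYne f
    let g : V → ℕ := fun v => if v ∈ X then mX - f v else (2 * q - 1) + nY - f v
    Function.Injective g ∧
    (∀ x ∈ X, ∀ y ∈ Y, g x < g y) ∧
    {n : ℕ | ∃ u v, G.Adj u v ∧ n = 2 * q - Nat.dist (f u) (f v)}
        = {n : ℕ | Odd n ∧ n < 2 * q} ∧
    (∀ u v, G.Adj u v →
      Nat.dist (Nat.dist (g u) (g v)) (2 * q - Nat.dist (f u) (f v))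
        = nY - mX - 1) := by
  intro mX nY g
  have hX : ∀ x ∈ X, f x ≤ mX := fun x hx => Finset.le_sup' f hx
  have hY : ∀ y ∈ Y, nY ≤ f y := fun y hy => Finset.inf'_le f hy
  have hlt : mX < nY := by
    obtain ⟨a, ha, ha'⟩ := Finset.exists_mem_eq_sup' hXne f
    obtain ⟨b, hb, hb'⟩ := Finset.exists_mem_eq_inf' hYne f
    have h := hso a ha b hb
    rw [← ha', ← hb'] at h
    exact h
  have gX : ∀ x ∈ X, g x = mX - f x := fun x hx => if_pos hx
  have gY : ∀ y ∈ Y, g y = (2 * q - 1) + nY - f y := fun y hy =>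
    if_neg (fun hx => Finset.disjoint_left.mp hdisj hx hy)
  have hc : ∀ v, v ∈ X ∨ v ∈ Y := fun v => by
    rw [← Finset.mem_union, hcover]; exact Finset.mem_univ v
  have hmem : ∀ n : ℕ, (∃ u v, G.Adj u v ∧ n = Nat.dist (f u) (f v)) ↔ (Odd n ∧ n < 2 * q) :=
    fun n => Set.ext_iff.mp hedges n
  refine ⟨?_, ?_, ?_, ?_⟩
  · intro u v huv
    apply hinj
    have bu := hbd u
    have bv := hbd v
    rcases hc u with hu | hu <;> rcases hc v with hv | hv
    · rw [gX u hu, gX v hv] at huv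
      have := hX u hu
      have := hX v hv
      omega
    · rw [gX u hu, gY v hv] at huv
      omega
    · rw [gY u hu, gX v hv] at huv
      omega
    · rw [gY u hu, gY v hv] at huv
      omega
  · intro x hx y hy
    rw [gX x hx, gY y hy]
    have := hbd y
    omega
  · ext n
    simp only [Set.mem_setOf_eq]
    constructor
    · rintro ⟨u, v, huv, rfl⟩
      obtain ⟨⟨k, hk⟩, h2⟩ := (hmem _).1 ⟨u, v, huv, rfl⟩
      exact ⟨⟨q - k - 1, by omega⟩, by omega⟩
    · rintro ⟨⟨k, hk⟩, h2⟩
      obtain ⟨u, v, huv, h⟩ := (hmem (2 * q - n)).2 ⟨⟨q - k - 1, by omega⟩, by omega⟩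
      exact ⟨u, v, huv, by omega⟩
  · intro u v huv
    have bu := hbd u
    have bv := hbd v
    rcases hbip u v huv with ⟨hu, hv⟩ | ⟨hu, hv⟩
    · rw [gX u hu, gY v hv]
      have := hX u hu
      have := hY v hv
      simp only [Nat.dist]
      omega
    · rw [gY u hu, gX v hv]
      have := hY u hu
      have := hX v hv
      simp only [Nat.dist]
      omega
end

section
/- Every finite tree T with q ≥ 1 edges admits an odd-edge edge-difference total coloring: there exist a constant k and an assignment f of natural numbers to the vertices and edges of T such that the set of edge colors {f(e) : e ∈ E(T)} equals the odd set {1,3,…,2q−1} and f(uv) + |f(u) − f(v)| = k for every edge uv of T. -/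
/-- Any edge weight on a tree is realised as the differences of a vertex potential. -/
theorem tree_potential {V : Type*} [DecidableEq V] (T : SimpleGraph V) (hT : T.IsTree)
    (w : Sym2 V → ℕ) :
    ∃ fV : V → ℕ, ∀ u v, T.Adj u v → Nat.dist (fV u) (fV v) = w s(u, v) := by
  obtain ⟨r⟩ := hT.1.nonempty
  have hex : ∀ v, ∃ p : T.Walk r v, p.IsPath := fun v => (hT.existsUnique_path r v).exists
  choose p hp using hex
  have huniq : ∀ v (q : T.Walk r v), q.IsPath → q = p v := fun v q hq =>
    (hT.existsUnique_path r v).unique hq (hp v)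
  have key : ∀ u v (h : T.Adj u v), v ∉ (p u).support →
      ((p v).edges.map w).sum = ((p u).edges.map w).sum + w s(u, v) := by
    intro u v h hn
    have := huniq v ((p u).concat h) ((hp u).concat hn h)
    rw [← this, SimpleGraph.Walk.edges_concat]
    simp
  refine ⟨fun v => ((p v).edges.map w).sum, fun u v h => ?_⟩
  by_cases hn : v ∈ (p u).support
  · have h1 := huniq v ((p u).takeUntil v hn) ((hp u).takeUntil hn)
    have h2 : u ∉ (p v).support := by
      rw [← h1]
      exact SimpleGraph.Walk.endpoint_notMem_support_takeUntil (hp u) hn h.ne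
    have := key v u h.symm h2
    simp only [this, Nat.dist, Sym2.eq_swap (a := v)]
    omega
  · have := key u v h hn
    simp only [this, Nat.dist]
    omega


/-- Every finite tree `T` with `q ≥ 1` edges admits an odd-edge
edge-difference total coloring: there are a constant `k` and colors on vertices and
edges such that the edge-color set is exactly `{1, 3, …, 2q - 1}` and
`f(uv) + |f(u) - f(v)| = k` for every edge `uv`. -/
theorem tree_admits_odd_edge_edge_difference_total_coloring
    {V : Type*} [Fintype V] [DecidableEq V]
    (T : SimpleGraph V) [DecidableRel T.Adj]
    (hT : T.IsTree)
    (q : ℕ) (hq : q = T.edgeFinset.card) (hq1 : 1 ≤ q) :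
    ∃ (fV : V → ℕ) (fE : Sym2 V → ℕ) (k : ℕ),
      fE '' T.edgeSet = {n : ℕ | Odd n ∧ n < 2 * q} ∧
      ∀ u v, T.Adj u v → fE s(u, v) + Nat.dist (fV u) (fV v) = k := by
  subst hq
  let e := T.edgeFinset.equivFin
  let fE : Sym2 V → ℕ := fun x => if h : x ∈ T.edgeFinset then 2 * (e ⟨x, h⟩).val + 1 else 0
  obtain ⟨fV, hfV⟩ := tree_potential T hT (fun x => 2 * T.edgeFinset.card - fE x)
  have hlt : ∀ x (h : x ∈ T.edgeFinset), fE x < 2 * T.edgeFinset.card := by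
    intro x h
    have := (e ⟨x, h⟩).isLt
    simp only [fE, dif_pos h]
    omega
  refine ⟨fV, fE, 2 * T.edgeFinset.card, ?_, ?_⟩
  · ext n
    constructor
    · rintro ⟨x, hx, rfl⟩
      have hx' : x ∈ T.edgeFinset := SimpleGraph.mem_edgeFinset.2 hx
      refine ⟨?_, hlt x hx'⟩
      simp only [fE, dif_pos hx']
      exact ⟨_, rfl⟩
    · rintro ⟨⟨m, rfl⟩, hn⟩
      have hm : m < T.edgeFinset.card := by omega
      refine ⟨(e.symm ⟨m, hm⟩).1, SimpleGraph.mem_edgeFinset.1 (e.symm ⟨m, hm⟩).2, ?_⟩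
      have h2 := (e.symm ⟨m, hm⟩).2
      simp only [fE, dif_pos h2, Subtype.coe_eta, Equiv.apply_symm_apply]
  · intro u v h
    rw [hfV u v h]
    have := hlt s(u, v) (SimpleGraph.mem_edgeFinset.2 h)
    omega
end
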